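/- For 1 < p < ∞ there exists a constant C_p such that for every non-negative weight sequence w : ℤ → ℝ≥0 and every a ∈ ℓᵖ(ℤ), ∑_{m∈ℤ} (Ma(m))^p w(m) ≤ C_p ∑_{m∈ℤ} |a(m)|^p Mw(m), where M is the Hardy-Littlewood maximal operator on ℤ. -/

import Mathlib

open scoped ENNReal BigOperators NNReal

/-- Average of `|a|` over a finite set of integers, valued in `ℝ≥0∞`. -/
noncomputable def eavg (a : ℤ → ℝ) (I : Finset ℤ) : ℝ≥0∞ :=
  (∑ n ∈ I, ENNReal.ofReal |a n|) / (I.card : ℝ≥0∞)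

/-- Uncentered Hardy–Littlewood maximal operator over finite intervals of ℤ. -/
noncomputable def Mhl (a : ℤ → ℝ) (m : ℤ) : ℝ≥0∞ :=
  ⨆ (i : ℤ) (j : ℤ) (_ : m ∈ Finset.Icc i j), eavg a (Finset.Icc i j)


noncomputable def ME (f : ℤ → ℝ≥0∞) (m : ℤ) : ℝ≥0∞ :=
  ⨆ (i : ℤ) (j : ℤ) (_ : m ∈ Finset.Icc i j), (∑ n ∈ Finset.Icc i j, f n) / ((Finset.Icc i j).card : ℝ≥0∞)

lemma Mhl_eq (a : ℤ → ℝ) : Mhl a = ME (fun n => ENNReal.ofReal |a n|) := rfl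

lemma le_ME (f : ℤ → ℝ≥0∞) {m i j : ℤ} (h : m ∈ Finset.Icc i j) :
    (∑ n ∈ Finset.Icc i j, f n) / ((Finset.Icc i j).card : ℝ≥0∞) ≤ ME f m :=
  le_iSup_of_le i (le_iSup_of_le j (le_iSup_of_le h le_rfl))

lemma card_ne {m i j : ℤ} (h : m ∈ Finset.Icc i j) : ((Finset.Icc i j).card : ℝ≥0∞) ≠ 0 := by
  have := Finset.card_pos.2 ⟨m, h⟩
  exact_mod_cast this.ne'

lemma ME_le_add (f g : ℤ → ℝ≥0∞) (c : ℝ≥0∞) (h : ∀ n, f n ≤ g n + c) (m : ℤ) :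
    ME f m ≤ ME g m + c := by
  refine iSup_le fun i => iSup_le fun j => iSup_le fun hm => ?_
  have h1 : (∑ n ∈ Finset.Icc i j, f n) ≤
      (∑ n ∈ Finset.Icc i j, g n) + ((Finset.Icc i j).card : ℝ≥0∞) * c := by
    calc _ ≤ ∑ n ∈ Finset.Icc i j, (g n + c) := Finset.sum_le_sum fun n _ => h n
      _ = _ := by rw [Finset.sum_add_distrib, Finset.sum_const, nsmul_eq_mul]
  calc _ ≤ ((∑ n ∈ Finset.Icc i j, g n) + ((Finset.Icc i j).card : ℝ≥0∞) * c) /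
        ((Finset.Icc i j).card : ℝ≥0∞) := by gcongr
    _ = (∑ n ∈ Finset.Icc i j, g n) / ((Finset.Icc i j).card : ℝ≥0∞) + c := by
      rw [ENNReal.add_div, mul_comm, ENNReal.mul_div_cancel_right (card_ne hm) (by simp)]
    _ ≤ _ := by gcongr; exact le_ME g hm

lemma local_est (f w : ℤ → ℝ≥0∞) (l : ℝ≥0∞) (i j : ℤ) (hij : i ≤ j)
    (h : l < (∑ n ∈ Finset.Icc i j, f n) / ((Finset.Icc i j).card : ℝ≥0∞)) :
    l * ∑ n ∈ Finset.Icc (i - 2 * (j - i + 1)) (j + 2 * (j - i + 1)), w n ≤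
      5 * ∑ n ∈ Finset.Icc i j, f n * ME w n := by
  set J := Finset.Icc (i - 2 * (j - i + 1)) (j + 2 * (j - i + 1)) with hJ
  set I := Finset.Icc i j with hI
  have hc : (J.card : ℝ≥0∞) = 5 * (I.card : ℝ≥0∞) := by
    have : J.card = 5 * I.card := by
      rw [hJ, hI, Int.card_Icc, Int.card_Icc]; omega
    rw [this]; push_cast; rfl
  have hi : i ∈ I := by simp [hI, hij]
  have hI0 : (I.card : ℝ≥0∞) ≠ 0 := card_ne hi
  have key : ∀ n ∈ I, ∑ n ∈ J, w n ≤ 5 * (I.card : ℝ≥0∞) * ME w n := by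
    intro n hn
    have hn' : n ∈ J := by
      simp only [hI, hJ, Finset.mem_Icc] at hn ⊢; omega
    have := le_ME w hn'
    rw [← hJ] at this
    rw [← hc, mul_comm]
    exact (ENNReal.div_le_iff (card_ne hn') (by simp)).1 this
  calc l * ∑ n ∈ J, w n ≤ ((∑ n ∈ I, f n) / (I.card : ℝ≥0∞)) * ∑ n ∈ J, w n := by gcongr
    _ = (∑ n ∈ I, f n * ∑ n ∈ J, w n) / (I.card : ℝ≥0∞) := by
      rw [← Finset.sum_mul, div_eq_mul_inv, div_eq_mul_inv]; ring
    _ ≤ (∑ n ∈ I, f n * (5 * (I.card : ℝ≥0∞) * ME w n)) / (I.card : ℝ≥0∞) := by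
      gcongr with n hn; exact key n hn
    _ = ((5 * ∑ n ∈ I, f n * ME w n) * (I.card : ℝ≥0∞)) / (I.card : ℝ≥0∞) := by
      congr 1
      rw [Finset.mul_sum, Finset.sum_mul]
      exact Finset.sum_congr rfl fun n _ => by ring
    _ = _ := ENNReal.mul_div_cancel_right hI0 (by simp)

lemma sum_biUnion_le' (u : Finset ℤ) (K : ℤ → Finset ℤ) (w : ℤ → ℝ≥0∞) :
    ∑ m ∈ u.biUnion K, w m ≤ ∑ b ∈ u, ∑ m ∈ K b, w m := by
  classical
  induction u using Finset.induction_on with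
  | empty => simp
  | insert b u hb ih =>
    rw [Finset.biUnion_insert, Finset.sum_insert hb]
    refine le_trans ?_ (add_le_add_right ih _)
    rw [← Finset.sum_union_inter]
    exact le_self_add

lemma weak_fin (f w : ℤ → ℝ≥0∞) (l : ℝ≥0∞) (F : Finset ℤ) (hF : ∀ m ∈ F, l < ME f m) :
    l * ∑ m ∈ F, w m ≤ 5 * ∑' m, f m * ME w m := by
  classical
  have h1 : ∀ m : ℤ, ∃ q : ℤ × ℤ, m ∈ Finset.Icc q.1 q.2 ∧ (m ∈ F →
      l < (∑ n ∈ Finset.Icc q.1 q.2, f n) / ((Finset.Icc q.1 q.2).card : ℝ≥0∞)) := by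
    intro m
    by_cases hm : m ∈ F
    · have := hF m hm
      simp only [ME, lt_iSup_iff] at this
      obtain ⟨i, j, h, h'⟩ := this
      exact ⟨(i, j), h, fun _ => h'⟩
    · exact ⟨(m, m), by simp, fun h => absurd h hm⟩
  choose q hq hq' using h1
  have hle : ∀ m, (q m).1 ≤ (q m).2 := fun m => by
    have := Finset.mem_Icc.1 (hq m); omega
  obtain ⟨u, huF, hdis, hcov⟩ := Vitali.exists_disjoint_subfamily_covering_enlargement
    (fun m => (Finset.Icc (q m).1 (q m).2 : Set ℤ)) (F : Set ℤ)
    (fun m => (((q m).2 - (q m).1 + 1 : ℤ) : ℝ)) 2 one_lt_two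
    (fun a _ => by
      have := hle a
      exact_mod_cast (by omega : 0 ≤ (q a).2 - (q a).1 + 1))
    (∑ m ∈ F, (((q m).2 - (q m).1 + 1 : ℤ) : ℝ))
    (fun a ha => Finset.single_le_sum (f := fun m => (((q m).2 - (q m).1 + 1 : ℤ) : ℝ))
      (fun b _ => by
        have := hle b
        exact_mod_cast (by omega : 0 ≤ (q b).2 - (q b).1 + 1)) ha)
    (fun a _ => ⟨a, by exact_mod_cast hq a⟩)
  have hufin : u.Finite := F.finite_toSet.subset huF
  lift u to Finset ℤ using hufin
  set K : ℤ → Finset ℤ := fun b => Finset.Icc ((q b).1 - 2 * ((q b).2 - (q b).1 + 1))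
    ((q b).2 + 2 * ((q b).2 - (q b).1 + 1)) with hK
  have hsub : F ⊆ u.biUnion K := by
    intro m hm
    obtain ⟨b, hb, ⟨x, hx⟩, hδ⟩ := hcov m hm
    have hδ' : (q m).2 - (q m).1 + 1 ≤ 2 * ((q b).2 - (q b).1 + 1) := by exact_mod_cast hδ
    have hmm := hq m
    simp only [Finset.coe_Icc, Set.mem_inter_iff, Set.mem_Icc] at hx
    simp only [Finset.mem_biUnion, hK, Finset.mem_Icc] at hmm ⊢
    exact ⟨b, hb, by omega, by omega⟩
  have hdis' : (u : Set ℤ).PairwiseDisjoint (fun m => Finset.Icc (q m).1 (q m).2) := by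
    intro a ha b hb hab
    exact Finset.disjoint_coe.1 (hdis ha hb hab)
  calc l * ∑ m ∈ F, w m ≤ l * ∑ b ∈ u, ∑ m ∈ K b, w m := by
        gcongr
        exact (Finset.sum_le_sum_of_subset hsub).trans (sum_biUnion_le' u K w)
    _ = ∑ b ∈ u, l * ∑ m ∈ K b, w m := Finset.mul_sum _ _ _
    _ ≤ ∑ b ∈ u, 5 * ∑ n ∈ Finset.Icc (q b).1 (q b).2, f n * ME w n :=
        Finset.sum_le_sum fun b hb => local_est f w l _ _ (hle b) (hq' b (huF hb))
    _ = 5 * ∑ n ∈ u.biUnion (fun m => Finset.Icc (q m).1 (q m).2), f n * ME w n := by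
        rw [← Finset.mul_sum, Finset.sum_biUnion hdis']
    _ ≤ _ := by gcongr; exact ENNReal.sum_le_tsum _

open Classical in
lemma weak (f w : ℤ → ℝ≥0∞) (l : ℝ≥0∞) :
    l * ∑' m, (if l < ME f m then w m else 0) ≤ 5 * ∑' m, f m * ME w m := by
  rw [ENNReal.tsum_eq_iSup_sum, ENNReal.mul_iSup]
  refine iSup_le fun F => ?_
  rw [← Finset.sum_filter]
  exact weak_fin f w l _ (by simp)

open Classical in
lemma weak2 (f w : ℤ → ℝ≥0∞) (l : ℝ≥0∞) :
    l * ∑' m, (if 2 * l < ME f m then w m else 0) ≤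
      5 * ∑' m, (if l < f m then f m * ME w m else 0) := by
  have := weak (fun m => if l < f m then f m else 0) w l
  simp only [ite_mul, zero_mul] at this
  refine le_trans ?_ this
  gcongr with m
  split_ifs with h1 h2 h2
  · exact le_rfl
  · exfalso
    have := ME_le_add f (fun m => if l < f m then f m else 0) l (fun n => by
      split_ifs with h
      · exact le_self_add
      · simpa using h) m
    have h3 := h1.trans_le (this.trans (add_le_add_left (not_lt.1 h2) l))
    rw [two_mul] at h3
    exact lt_irrefl _ h3
  · exact zero_le
  · exact le_rfl

open Classical MeasureTheory in
lemma layer (s : ℝ) (hs : 0 < s) (x : ℝ≥0∞) (hx : x ≠ ∞) :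
    ∫⁻ t in Set.Ioi (0:ℝ), (if ENNReal.ofReal t < x then ENNReal.ofReal (t ^ (s - 1)) else 0)
      = x ^ s / ENNReal.ofReal s := by
  lift x to ℝ≥0 using hx
  have h1 : ∫⁻ t in Set.Ioi (0:ℝ), (if ENNReal.ofReal t < x then ENNReal.ofReal (t ^ (s - 1)) else 0)
      = ∫⁻ t in Set.Ioo (0:ℝ) x, ENNReal.ofReal (t ^ (s - 1)) := by
    rw [← lintegral_indicator measurableSet_Ioi, ← lintegral_indicator measurableSet_Ioo]
    congr 1
    ext t
    by_cases h : 0 < t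
    · have : ENNReal.ofReal t < x ↔ t < x := by
        rw [← ENNReal.ofReal_coe_nnreal, ENNReal.ofReal_lt_ofReal_iff_of_nonneg h.le]
      simp [Set.indicator, h, this]
    · simp [Set.indicator, h]
  have hint : IntervalIntegrable (fun t : ℝ => t ^ (s - 1)) volume 0 x :=
    intervalIntegral.intervalIntegrable_rpow' (by linarith)
  rw [h1, restrict_Ioo_eq_restrict_Ioc, ← ofReal_integral_eq_lintegral_ofReal,
    ← intervalIntegral.integral_of_le x.coe_nonneg, integral_rpow (Or.inl (by linarith))]
  · rw [sub_add_cancel, Real.zero_rpow hs.ne', sub_zero, ENNReal.ofReal_div_of_pos hs,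
      ← ENNReal.ofReal_rpow_of_nonneg x.coe_nonneg hs.le]
    simp
  · exact (intervalIntegrable_iff_integrableOn_Ioc_of_le x.coe_nonneg).1 hint
  · filter_upwards [ae_restrict_mem measurableSet_Ioc] with t ht
    exact Real.rpow_nonneg ht.1.le _

open Classical MeasureTheory in
lemma main_est (p : ℝ) (hp : 1 < p) (f w : ℤ → ℝ≥0∞) (B : ℝ≥0∞) (hB : B ≠ ∞)
    (hf : ∀ n, f n ≤ B) :
    ∑' m, ME f m ^ p * w m ≤
      (ENNReal.ofReal p * 2 ^ p * 5 / ENNReal.ofReal (p - 1)) * ∑' m, f m ^ p * ME w m := by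
  have hME : ∀ m, ME f m ≤ B := fun m => by
    have := ME_le_add f (fun _ => 0) B (fun n => by simpa using hf n) m
    simpa [ME] using this
  have hp0 : 0 < p := by linarith
  have hpE : ENNReal.ofReal p ≠ 0 := by simpa using hp0
  -- rescaled layer formula
  have e1 : ∀ m, ME f m ^ p * w m = ENNReal.ofReal p * 2 ^ p *
      ∫⁻ t in Set.Ioi (0:ℝ), ENNReal.ofReal (t ^ (p - 1)) *
        (if 2 * ENNReal.ofReal t < ME f m then w m else 0) := by
    intro m
    have h := layer p hp0 (ME f m / 2)
      (ENNReal.div_ne_top ((hME m).trans_lt hB.lt_top).ne (by simp))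
    have h2 : ∀ t : ℝ, ENNReal.ofReal (t ^ (p - 1)) *
        (if 2 * ENNReal.ofReal t < ME f m then w m else 0) =
        (if ENNReal.ofReal t < ME f m / 2 then ENNReal.ofReal (t ^ (p - 1)) else 0) * w m := by
      intro t
      have : ENNReal.ofReal t < ME f m / 2 ↔ 2 * ENNReal.ofReal t < ME f m := by
        rw [ENNReal.lt_div_iff_mul_lt (by simp) (by simp), mul_comm]
      simp only [this]
      split_ifs <;> simp
    simp_rw [h2]
    rw [lintegral_mul_const _ (by
      refine Measurable.ite ?_ ?_ measurable_const
      · exact measurableSet_lt ENNReal.measurable_ofReal measurable_const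
      · fun_prop), h, ENNReal.div_rpow_of_nonneg _ _ hp0.le]
    rw [← mul_assoc]
    congr 1
    have h2p : (2:ℝ≥0∞) ^ p ≠ 0 := by simp [hp0.le]
    have h2p' : (2:ℝ≥0∞) ^ p ≠ ∞ := ENNReal.rpow_ne_top_of_nonneg hp0.le (by simp)
    rw [mul_comm (ENNReal.ofReal p), mul_assoc, ENNReal.mul_div_cancel hpE (by simp),
      ENNReal.mul_div_cancel h2p h2p']
  have meas : ∀ (x y : ℝ≥0∞) , Measurable fun t : ℝ => if ENNReal.ofReal t < x then y else 0 := by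
    intro x y
    exact Measurable.ite (measurableSet_lt ENNReal.measurable_ofReal measurable_const)
      measurable_const measurable_const
  have meas2 : ∀ (x y : ℝ≥0∞) , Measurable fun t : ℝ => if 2 * ENNReal.ofReal t < x then y else 0 := by
    intro x y
    exact Measurable.ite (measurableSet_lt (by fun_prop) measurable_const)
      measurable_const measurable_const
  have mpow : ∀ r : ℝ, Measurable fun t : ℝ => ENNReal.ofReal (t ^ r) := fun r => by fun_prop
  simp_rw [e1]
  rw [ENNReal.tsum_mul_left, ← lintegral_tsum (f := fun (m : ℤ) (t : ℝ) => ENNReal.ofReal (t ^ (p - 1)) *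
        (if 2 * ENNReal.ofReal t < ME f m then w m else 0))
      (fun m => ((mpow _).mul (meas2 _ _)).aemeasurable)]
  have e2 : ∫⁻ t in Set.Ioi (0:ℝ), ∑' m, ENNReal.ofReal (t ^ (p - 1)) *
        (if 2 * ENNReal.ofReal t < ME f m then w m else 0) ≤
      ∫⁻ t in Set.Ioi (0:ℝ), ∑' m, 5 * (ENNReal.ofReal (t ^ (p - 1 - 1)) *
        (if ENNReal.ofReal t < f m then f m * ME w m else 0)) := by
    refine setLIntegral_mono' measurableSet_Ioi fun t ht => ?_
    have ht : 0 < t := ht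
    have : ENNReal.ofReal (t ^ (p - 1)) = ENNReal.ofReal (t ^ (p - 1 - 1)) * ENNReal.ofReal t := by
      rw [← ENNReal.ofReal_mul (Real.rpow_nonneg ht.le _), ← Real.rpow_add_one ht.ne']
      simp
    rw [ENNReal.tsum_mul_left, ENNReal.tsum_mul_left, ENNReal.tsum_mul_left, this, mul_assoc,
      mul_left_comm 5]
    exact mul_le_mul_right (weak2 f w _) _
  have e3 : ∫⁻ t in Set.Ioi (0:ℝ), ∑' m, 5 * (ENNReal.ofReal (t ^ (p - 1 - 1)) *
        (if ENNReal.ofReal t < f m then f m * ME w m else 0)) =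
      5 / ENNReal.ofReal (p - 1) * ∑' m, f m ^ p * ME w m := by
    rw [lintegral_tsum (f := fun (m : ℤ) (t : ℝ) => 5 * (ENNReal.ofReal (t ^ (p - 1 - 1)) *
        (if ENNReal.ofReal t < f m then f m * ME w m else 0)))
      (fun m => (((mpow _).mul (meas _ _)).const_mul 5).aemeasurable),
      ← ENNReal.tsum_mul_left]
    congr 1
    ext m
    have h := layer (p - 1) (by linarith) (f m) ((hf m).trans_lt hB.lt_top).ne
    have h2 : ∀ t : ℝ, ENNReal.ofReal (t ^ (p - 1 - 1)) *
        (if ENNReal.ofReal t < f m then f m * ME w m else 0) =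
        (if ENNReal.ofReal t < f m then ENNReal.ofReal (t ^ (p - 1 - 1)) else 0) * (f m * ME w m) := by
      intro t
      split_ifs <;> simp
    simp_rw [h2]
    have mm : Measurable fun t : ℝ =>
        (if ENNReal.ofReal t < f m then ENNReal.ofReal (t ^ (p - 1 - 1)) else 0) :=
      Measurable.ite (measurableSet_lt ENNReal.measurable_ofReal measurable_const) (mpow _)
        measurable_const
    rw [lintegral_const_mul _ (mm.mul_const _), lintegral_mul_const _ mm, h]
    have : f m ^ p = f m ^ (p - 1) * f m := by
      nth_rewrite 3 [← ENNReal.rpow_one (f m)]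
      rw [← ENNReal.rpow_add_of_nonneg _ _ (by linarith) zero_le_one]
      simp
    rw [this, div_eq_mul_inv, div_eq_mul_inv]
    ring
  refine (mul_le_mul_right (e2.trans e3.le) _).trans_eq ?_
  rw [div_eq_mul_inv, div_eq_mul_inv]
  ring

theorem strong_p_with_Mw (p : ℝ) (hp : 1 < p) :
    ∃ C : ℝ≥0∞, C ≠ ∞ ∧ ∀ (w : ℤ → ℝ≥0) (a : ℤ → ℝ),
      Summable (fun n => |a n| ^ p) →
      (∑' m : ℤ, (Mhl a m) ^ p * (w m : ℝ≥0∞)) ≤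
        C * ∑' m : ℤ, ENNReal.ofReal (|a m| ^ p) * Mhl (fun n => (w n : ℝ)) m := by
  have hp0 : 0 < p := by linarith
  refine ⟨ENNReal.ofReal p * 2 ^ p * 5 / ENNReal.ofReal (p - 1), ?_, fun w a ha => ?_⟩
  · refine ENNReal.div_ne_top ?_ (by simpa using hp)
    exact ENNReal.mul_ne_top (ENNReal.mul_ne_top (by simp)
      (ENNReal.rpow_ne_top_of_nonneg hp0.le (by simp))) (by simp)
  have hw : (fun n => ENNReal.ofReal |((w n : ℝ≥0) : ℝ)|) = fun n => (w n : ℝ≥0∞) := by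
    ext n; simp
  have := main_est p hp (fun n => ENNReal.ofReal |a n|) (fun n => (w n : ℝ≥0∞))
    (ENNReal.ofReal ((∑' n, |a n| ^ p) ^ (1 / p))) (by simp) (fun n => by
      apply ENNReal.ofReal_le_ofReal
      have h1 : |a n| ^ p ≤ ∑' n, |a n| ^ p :=
        ha.le_tsum n (fun j _ => Real.rpow_nonneg (abs_nonneg _) _)
      calc |a n| = (|a n| ^ p) ^ (1 / p) := by
            rw [← Real.rpow_mul (abs_nonneg _), mul_one_div_cancel hp0.ne', Real.rpow_one]
        _ ≤ _ := Real.rpow_le_rpow (Real.rpow_nonneg (abs_nonneg _) _) h1 (by positivity))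
  rw [Mhl_eq, Mhl_eq, hw]
  simpa only [ENNReal.ofReal_rpow_of_nonneg (abs_nonneg _) hp0.le] using this
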